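/- arXiv:1005.2442 — 3 statements merged into one kernel-verified Lean document; each statement's English description precedes it below -/
import Mathlib

section
/- Let A be an n×n complex matrix, C an m×n complex matrix, and γ : ℕ → {0,1} an arbitrary sequence. Let Q, Σ₀ be n×n Hermitian positive definite matrices, R an m×m Hermitian positive definite matrix, and let 0 < α ≤ ᾱ be reals with α·I ≤ Q ≤ ᾱ·I, α·I ≤ R ≤ ᾱ·I and α·I ≤ Σ₀ ≤ ᾱ·I. Define P₀ = Σ₀, P_{k+1} = A P_k A* + Q − γ_k A P_k C* (C P_k C* + R)⁻¹ C P_k A*, and P*₀ = I, P*_{k+1} = A P*_k A* + I − γ_k A P*_k C* (C P*_k C* + I)⁻¹ C P*_k A*. Then for every k, α·P*_k ≤ P_k ≤ ᾱ·P*_k in the Loewner (positive semidefinite) order. In particular, the sequence P_k is bounded above if and only if P*_k is, so boundedness depends only on (A,C) and not on Q, R, Σ₀. -/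
open Matrix MeasureTheory ProbabilityTheory
open scoped ComplexOrder ENNReal

/-- One step of the lossy Riccati recursion:
`X ↦ A X Aᴴ + Q − γ · A X Cᴴ (C X Cᴴ + R)⁻¹ C X Aᴴ`. -/
noncomputable def riccStep {ι κ : Type} [Fintype ι] [Fintype κ] [DecidableEq ι] [DecidableEq κ]
    (A : Matrix ι ι ℂ) (C : Matrix κ ι ℂ)
    (Q : Matrix ι ι ℂ) (R : Matrix κ κ ℂ) (g : ℝ)
    (X : Matrix ι ι ℂ) : Matrix ι ι ℂ :=
  A * X * Aᴴ + Q - (g : ℂ) • (A * X * Cᴴ * (C * X * Cᴴ + R)⁻¹ * (C * X * Aᴴ))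

/-- The lossy Riccati recursion `P₀ = S0`, `P_{k+1} = riccStep (γ k) (P k)`. -/
noncomputable def ricc {ι κ : Type} [Fintype ι] [Fintype κ] [DecidableEq ι] [DecidableEq κ]
    (A : Matrix ι ι ℂ) (C : Matrix κ ι ℂ)
    (Q : Matrix ι ι ℂ) (R : Matrix κ κ ℂ) (S0 : Matrix ι ι ℂ) (γ : ℕ → ℝ) :
    ℕ → Matrix ι ι ℂ
  | 0 => S0
  | k + 1 => riccStep A C Q R (γ k) (ricc A C Q R S0 γ k)

/-- Loewner order: `X ≤ Y` iff `Y - X` is positive semidefinite. -/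
def loe {ι : Type} [Fintype ι] (X Y : Matrix ι ι ℂ) : Prop := (Y - X).PosSemidef

/-- Entrywise expectation of a random matrix. -/
noncomputable def matExp {Ω ι κ : Type} [MeasurableSpace Ω] (μ : Measure Ω)
    (X : Ω → Matrix ι κ ℂ) : Matrix ι κ ℂ :=
  Matrix.of fun i j => ∫ ω, X ω i j ∂μ

/-- `sup_k E[P_k]` is bounded: the entries are integrable and there is a Hermitian matrix `M`
dominating every `E[P_k]` in the Loewner order. -/
def EBounded {Ω ι : Type} [Fintype ι] [MeasurableSpace Ω] (μ : Measure Ω)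
    (P : ℕ → Ω → Matrix ι ι ℂ) : Prop :=
  (∀ k i j, Integrable (fun ω => P k ω i j) μ) ∧
  ∃ M : Matrix ι ι ℂ, M.IsHermitian ∧ ∀ k, loe (matExp μ (P k)) M

/-- PBH detectability of `(C, A)`. -/
def Detectable {ι κ : Type} [Fintype ι] [Fintype κ] [DecidableEq ι]
    (A : Matrix ι ι ℂ) (C : Matrix κ ι ℂ) : Prop :=
  ∀ z : ℂ, 1 ≤ ‖z‖ →
    (Matrix.fromRows (A - z • (1 : Matrix ι ι ℂ)) C).rank = Fintype.card ι

/-- Non-degeneracy: for each equi-modulus index set `{j | |d j| = r}` the corresponding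
columns of `C` are linearly independent (i.e. `rank C_I = |I|`). -/
def NonDeg {ι κ : Type} (d : ι → ℂ) (C : Matrix κ ι ℂ) : Prop :=
  ∀ r : ℝ, LinearIndependent ℂ
    (fun j : {j : ι // ‖d j‖ = r} => fun i : κ => C i j.1)

section helpers
variable {ι κ : Type} [Fintype ι] [Fintype κ] [DecidableEq ι] [DecidableEq κ]

/-- Joseph form. -/
noncomputable def jos (A : Matrix ι ι ℂ) (C : Matrix κ ι ℂ) (Q : Matrix ι ι ℂ)
    (R : Matrix κ κ ℂ) (K : Matrix ι κ ℂ) (X : Matrix ι ι ℂ) : Matrix ι ι ℂ :=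
  (A - K * C) * X * (A - K * C)ᴴ + K * R * Kᴴ + Q

lemma S_posDef (C : Matrix κ ι ℂ) {R : Matrix κ κ ℂ} {X : Matrix ι ι ℂ}
    (hR : R.PosDef) (hX : X.PosSemidef) : (C * X * Cᴴ + R).PosDef :=
  Matrix.PosDef.posSemidef_add (hX.mul_mul_conjTranspose_same C) hR

lemma jos_sub (A : Matrix ι ι ℂ) (C : Matrix κ ι ℂ) (Q : Matrix ι ι ℂ)
    {R : Matrix κ κ ℂ} (K : Matrix ι κ ℂ) {X : Matrix ι ι ℂ}
    (hR : R.PosDef) (hX : X.PosSemidef) :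
    jos A C Q R K X - riccStep A C Q R 1 X =
      (K - A * X * Cᴴ * (C * X * Cᴴ + R)⁻¹) * (C * X * Cᴴ + R) *
        (K - A * X * Cᴴ * (C * X * Cᴴ + R)⁻¹)ᴴ := by
  have hS := S_posDef C hR hX
  have hu : IsUnit (C * X * Cᴴ + R).det := (Matrix.isUnit_iff_isUnit_det _).1 hS.isUnit
  have hH : ((C * X * Cᴴ + R)⁻¹)ᴴ = (C * X * Cᴴ + R)⁻¹ := hS.isHermitian.inv
  have hXH : Xᴴ = X := hX.isHermitian
  have e1 : (K - A * X * Cᴴ * (C * X * Cᴴ + R)⁻¹) * (C * X * Cᴴ + R)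
      = K * (C * X * Cᴴ + R) - A * X * Cᴴ := by
    rw [Matrix.sub_mul, Matrix.nonsing_inv_mul_cancel_right _ _ hu]
  have e2 : (K - A * X * Cᴴ * (C * X * Cᴴ + R)⁻¹)ᴴ
      = Kᴴ - (C * X * Cᴴ + R)⁻¹ * (C * X * Aᴴ) := by
    rw [conjTranspose_sub, conjTranspose_mul _ ((C * X * Cᴴ + R)⁻¹), hH]
    simp only [conjTranspose_mul, hXH, conjTranspose_conjTranspose, Matrix.mul_assoc]
  have e3 : K * (C * X * Cᴴ + R) * ((C * X * Cᴴ + R)⁻¹ * (C * X * Aᴴ)) = K * (C * X * Aᴴ) := by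
    rw [Matrix.mul_assoc, Matrix.mul_nonsing_inv_cancel_left _ _ hu]
  rw [e1, e2, Matrix.mul_sub, Matrix.sub_mul (K * (C * X * Cᴴ + R)),
    Matrix.sub_mul (K * (C * X * Cᴴ + R)), e3]
  unfold jos riccStep
  generalize (C * X * Cᴴ + R)⁻¹ = Si
  simp only [conjTranspose_sub, conjTranspose_mul, Matrix.mul_add, Matrix.add_mul,
    Matrix.mul_sub, Matrix.sub_mul, Matrix.mul_assoc, Complex.ofReal_one, one_smul]
  abel

lemma jos_mono (A : Matrix ι ι ℂ) (C : Matrix κ ι ℂ) {Q Q' : Matrix ι ι ℂ}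
    {R R' : Matrix κ κ ℂ} (K : Matrix ι κ ℂ) {X X' : Matrix ι ι ℂ}
    (hQ : loe Q Q') (hR : loe R R') (hX : loe X X') :
    loe (jos A C Q R K X) (jos A C Q' R' K X') := by
  unfold loe at *
  have h := ((hX.mul_mul_conjTranspose_same (A - K * C)).add
    (hR.mul_mul_conjTranspose_same K)).add hQ
  convert h using 1
  unfold jos
  rw [Matrix.mul_sub (A - K * C), Matrix.sub_mul _ _ ((A - K * C)ᴴ), Matrix.mul_sub K,
    Matrix.sub_mul _ _ (Kᴴ)]
  abel

lemma jos_psd (A : Matrix ι ι ℂ) (C : Matrix κ ι ℂ) {Q : Matrix ι ι ℂ}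
    {R : Matrix κ κ ℂ} (K : Matrix ι κ ℂ) {X : Matrix ι ι ℂ}
    (hQ : Q.PosSemidef) (hR : R.PosSemidef) (hX : X.PosSemidef) :
    (jos A C Q R K X).PosSemidef :=
  ((hX.mul_mul_conjTranspose_same (A - K * C)).add (hR.mul_mul_conjTranspose_same K)).add hQ

lemma step_zero (A : Matrix ι ι ℂ) (C : Matrix κ ι ℂ) (Q : Matrix ι ι ℂ)
    (R : Matrix κ κ ℂ) (X : Matrix ι ι ℂ) : riccStep A C Q R 0 X = jos A C Q R 0 X := by
  simp [riccStep, jos]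

lemma step_one (A : Matrix ι ι ℂ) (C : Matrix κ ι ℂ) (Q : Matrix ι ι ℂ)
    {R : Matrix κ κ ℂ} {X : Matrix ι ι ℂ} (hR : R.PosDef) (hX : X.PosSemidef) :
    riccStep A C Q R 1 X = jos A C Q R (A * X * Cᴴ * (C * X * Cᴴ + R)⁻¹) X := by
  have h := jos_sub A C Q (A * X * Cᴴ * (C * X * Cᴴ + R)⁻¹) hR hX
  rw [sub_self, Matrix.zero_mul, Matrix.zero_mul] at h
  exact (sub_eq_zero.1 h).symm

lemma loe_trans' {X Y Z : Matrix ι ι ℂ} (h : loe X Y) (h' : loe Y Z) : loe X Z := by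
  unfold loe at *
  have := h.add h'
  rwa [show Y - X + (Z - Y) = Z - X by abel] at this

lemma loe_smul {c : ℝ} (hc : 0 ≤ c) {X Y : Matrix ι ι ℂ} (h : loe X Y) :
    loe ((c : ℂ) • X) ((c : ℂ) • Y) := by
  unfold loe at *
  rw [← smul_sub]
  exact h.smul (by exact_mod_cast hc)

lemma step_psd (A : Matrix ι ι ℂ) (C : Matrix κ ι ℂ) {Q : Matrix ι ι ℂ}
    {R : Matrix κ κ ℂ} {X : Matrix ι ι ℂ} {g : ℝ} (hg : g = 0 ∨ g = 1)
    (hQ : Q.PosDef) (hR : R.PosDef) (hX : X.PosSemidef) :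
    (riccStep A C Q R g X).PosSemidef := by
  rcases hg with rfl | rfl
  · rw [step_zero]; exact jos_psd A C _ hQ.posSemidef hR.posSemidef hX
  · rw [step_one A C Q hR hX]; exact jos_psd A C _ hQ.posSemidef hR.posSemidef hX

lemma step_mono (A : Matrix ι ι ℂ) (C : Matrix κ ι ℂ) {Q Q' : Matrix ι ι ℂ}
    {R R' : Matrix κ κ ℂ} {X X' : Matrix ι ι ℂ} {g : ℝ} (hg : g = 0 ∨ g = 1)
    (hQ : loe Q Q') (hR : loe R R') (hX : loe X X')
    (pR : R.PosDef) (pR' : R'.PosDef) (pX : X.PosSemidef) (pX' : X'.PosSemidef) :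
    loe (riccStep A C Q R g X) (riccStep A C Q' R' g X') := by
  rcases hg with rfl | rfl
  · rw [step_zero, step_zero]; exact jos_mono A C _ hQ hR hX
  · rw [step_one A C Q' pR' pX']
    refine loe_trans' ?_ (jos_mono A C _ hQ hR hX)
    unfold loe
    rw [jos_sub A C Q _ pR pX]
    exact (S_posDef C pR pX).posSemidef.mul_mul_conjTranspose_same _

lemma ricc_psd (A : Matrix ι ι ℂ) (C : Matrix κ ι ℂ) {Q S : Matrix ι ι ℂ}
    {R : Matrix κ κ ℂ} {γ : ℕ → ℝ} (hγ : ∀ k, γ k = 0 ∨ γ k = 1)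
    (hQ : Q.PosDef) (hR : R.PosDef) (hS : S.PosDef) (k : ℕ) :
    (ricc A C Q R S γ k).PosSemidef := by
  induction k with
  | zero => exact hS.posSemidef
  | succ k ih => exact step_psd A C (hγ k) hQ hR ih

lemma ricc_mono (A : Matrix ι ι ℂ) (C : Matrix κ ι ℂ) {Q S Q' S' : Matrix ι ι ℂ}
    {R R' : Matrix κ κ ℂ} {γ : ℕ → ℝ} (hγ : ∀ k, γ k = 0 ∨ γ k = 1)
    (pQ : Q.PosDef) (pR : R.PosDef) (pS : S.PosDef)
    (pQ' : Q'.PosDef) (pR' : R'.PosDef) (pS' : S'.PosDef)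
    (hQ : loe Q Q') (hR : loe R R') (hS : loe S S') (k : ℕ) :
    loe (ricc A C Q R S γ k) (ricc A C Q' R' S' γ k) := by
  induction k with
  | zero => exact hS
  | succ k ih =>
    exact step_mono A C (hγ k) hQ hR ih pR pR' (ricc_psd A C hγ pQ pR pS k)
      (ricc_psd A C hγ pQ' pR' pS' k)

lemma step_smul (A : Matrix ι ι ℂ) (C : Matrix κ ι ℂ) (Q : Matrix ι ι ℂ)
    {R : Matrix κ κ ℂ} {X : Matrix ι ι ℂ} (g : ℝ) {c : ℂ} (hc : c ≠ 0)
    (hR : R.PosDef) (hX : X.PosSemidef) :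
    riccStep A C (c • Q) (c • R) g (c • X) = c • riccStep A C Q R g X := by
  have hS := S_posDef C hR hX
  have hu : IsUnit (C * X * Cᴴ + R).det := (Matrix.isUnit_iff_isUnit_det _).1 hS.isUnit
  have e : (c • (C * X * Cᴴ + R))⁻¹ = c⁻¹ • (C * X * Cᴴ + R)⁻¹ := by
    apply Matrix.inv_eq_right_inv
    rw [Matrix.smul_mul, Matrix.mul_smul, smul_smul, mul_inv_cancel₀ hc, one_smul,
      Matrix.mul_nonsing_inv _ hu]
  unfold riccStep
  simp only [Matrix.mul_smul, Matrix.smul_mul, ← smul_add, e, smul_smul, smul_sub]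
  congr 2
  field_simp

lemma ricc_smul (A : Matrix ι ι ℂ) (C : Matrix κ ι ℂ) {Q S : Matrix ι ι ℂ}
    {R : Matrix κ κ ℂ} {γ : ℕ → ℝ} (hγ : ∀ k, γ k = 0 ∨ γ k = 1)
    (pQ : Q.PosDef) (pR : R.PosDef) (pS : S.PosDef) {c : ℂ} (hc : c ≠ 0) (k : ℕ) :
    ricc A C (c • Q) (c • R) (c • S) γ k = c • ricc A C Q R S γ k := by
  induction k with
  | zero => rfl
  | succ k ih =>
    simp only [ricc]
    rw [ih, step_smul A C Q (γ k) hc pR (ricc_psd A C hγ pQ pR pS k)]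

lemma smul_one_posDef {c : ℝ} (hc : 0 < c) : ((c : ℂ) • (1 : Matrix ι ι ℂ)).PosDef :=
  Matrix.PosDef.one.smul (by exact_mod_cast hc)

end helpers

/-- sandwiching the lossy Riccati recursion with general positive definite
`Q, R, Sigma0` between scalar multiples of the recursion with identity parameters; in particular
boundedness depends only on `(A, C)` and the arrival sequence. -/
theorem stmt0 {n m : ℕ} (A : Matrix (Fin n) (Fin n) ℂ) (C : Matrix (Fin m) (Fin n) ℂ)
    (Q Sigma0 : Matrix (Fin n) (Fin n) ℂ) (R : Matrix (Fin m) (Fin m) ℂ)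
    (hQ : Q.PosDef) (hSigma : Sigma0.PosDef) (hR : R.PosDef)
    (γ : ℕ → ℝ) (hγ : ∀ k, γ k = 0 ∨ γ k = 1)
    (a b : ℝ) (ha : 0 < a) (hab : a ≤ b)
    (hQ1 : loe ((a : ℂ) • (1 : Matrix (Fin n) (Fin n) ℂ)) Q)
    (hQ2 : loe Q ((b : ℂ) • (1 : Matrix (Fin n) (Fin n) ℂ)))
    (hR1 : loe ((a : ℂ) • (1 : Matrix (Fin m) (Fin m) ℂ)) R)
    (hR2 : loe R ((b : ℂ) • (1 : Matrix (Fin m) (Fin m) ℂ)))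
    (hSigma1 : loe ((a : ℂ) • (1 : Matrix (Fin n) (Fin n) ℂ)) Sigma0)
    (hSigma2 : loe Sigma0 ((b : ℂ) • (1 : Matrix (Fin n) (Fin n) ℂ))) :
    (∀ k, loe ((a : ℂ) • ricc A C 1 1 1 γ k) (ricc A C Q R Sigma0 γ k) ∧
      loe (ricc A C Q R Sigma0 γ k) ((b : ℂ) • ricc A C 1 1 1 γ k)) ∧
    ((∃ M : Matrix (Fin n) (Fin n) ℂ, ∀ k, loe (ricc A C Q R Sigma0 γ k) M) ↔
      (∃ M : Matrix (Fin n) (Fin n) ℂ, ∀ k, loe (ricc A C 1 1 1 γ k) M)) := by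
  have hb : 0 < b := lt_of_lt_of_le ha hab
  have main : ∀ k, loe ((a : ℂ) • ricc A C 1 1 1 γ k) (ricc A C Q R Sigma0 γ k) ∧
      loe (ricc A C Q R Sigma0 γ k) ((b : ℂ) • ricc A C 1 1 1 γ k) := by
    intro k
    rw [← ricc_smul A C hγ Matrix.PosDef.one Matrix.PosDef.one Matrix.PosDef.one
        (Complex.ofReal_ne_zero.2 ha.ne') k,
      ← ricc_smul A C hγ Matrix.PosDef.one Matrix.PosDef.one Matrix.PosDef.one
        (Complex.ofReal_ne_zero.2 hb.ne') k]
    exact ⟨ricc_mono A C hγ (smul_one_posDef ha) (smul_one_posDef ha) (smul_one_posDef ha)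
        hQ hR hSigma hQ1 hR1 hSigma1 k,
      ricc_mono A C hγ hQ hR hSigma (smul_one_posDef hb) (smul_one_posDef hb)
        (smul_one_posDef hb) hQ2 hR2 hSigma2 k⟩
  refine ⟨main, ?_, ?_⟩
  · rintro ⟨M, hM⟩
    refine ⟨((a⁻¹ : ℝ) : ℂ) • M, fun k => ?_⟩
    have h := loe_smul (inv_nonneg.2 ha.le) (loe_trans' (main k).1 (hM k))
    rwa [smul_smul, ← Complex.ofReal_mul, inv_mul_cancel₀ ha.ne', Complex.ofReal_one,
      one_smul] at h
  · rintro ⟨M, hM⟩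
    exact ⟨(b : ℂ) • M, fun k => loe_trans' (main k).2 (loe_smul hb.le (hM k))⟩
end

section
/- Let A be an n×n complex matrix, C an m×n complex matrix, and γ ∈ {0,1}. Let X, X′ be n×n Hermitian positive semidefinite matrices with X ≤ X′, let Q, Q′ be n×n Hermitian matrices with Q ≤ Q′, and let R, R′ be m×m Hermitian positive definite matrices with R ≤ R′. Then A X A* + Q − γ · A X C* (C X C* + R)⁻¹ C X A* ≤ A X′ A* + Q′ − γ · A X′ C* (C X′ C* + R′)⁻¹ C X′ A* in the Loewner order. (Monotonicity of the lossy Riccati step in the state covariance, process noise and measurement noise.) -/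
open Matrix MeasureTheory ProbabilityTheory
open scoped ComplexOrder ENNReal

theorem ricc_gain_identity {n m : ℕ} (A : Matrix (Fin n) (Fin n) ℂ) (C : Matrix (Fin m) (Fin n) ℂ)
    (X : Matrix (Fin n) (Fin n) ℂ) (R T : Matrix (Fin m) (Fin m) ℂ) (L : Matrix (Fin n) (Fin m) ℂ)
    (hX : Xᴴ = X) (hT : Tᴴ = T) (h1 : (C * X * Cᴴ + R) * T = 1) (h2 : T * (C * X * Cᴴ + R) = 1) :
    A * X * Aᴴ - A * X * Cᴴ * T * (C * X * Aᴴ)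
      + (L - A * X * Cᴴ * T) * (C * X * Cᴴ + R) * (L - A * X * Cᴴ * T)ᴴ
      = (A - L * C) * X * (A - L * C)ᴴ + L * R * Lᴴ := by
  have e1 : (L - A * X * Cᴴ * T) * (C * X * Cᴴ + R) = L * (C * X * Cᴴ + R) - A * X * Cᴴ := by
    rw [Matrix.sub_mul, Matrix.mul_assoc (A * X * Cᴴ), h2, Matrix.mul_one]
  have e2 : (L - A * X * Cᴴ * T)ᴴ = Lᴴ - T * (C * X * Aᴴ) := by
    simp [Matrix.conjTranspose_mul, hX, hT, Matrix.mul_assoc]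
  have e3 : L * (C * X * Cᴴ + R) * (T * (C * X * Aᴴ)) = L * (C * X * Aᴴ) := by
    rw [Matrix.mul_assoc, ← Matrix.mul_assoc _ T, h1, Matrix.one_mul]
  rw [e1, e2, Matrix.mul_sub, Matrix.sub_mul, Matrix.sub_mul, e3]
  simp only [Matrix.conjTranspose_sub, Matrix.conjTranspose_mul, Matrix.mul_sub, Matrix.sub_mul,
    Matrix.mul_add, Matrix.add_mul, Matrix.mul_assoc]
  abel

theorem ricc_inv_facts {n m : ℕ} (C : Matrix (Fin m) (Fin n) ℂ)
    (X : Matrix (Fin n) (Fin n) ℂ) (R : Matrix (Fin m) (Fin m) ℂ)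
    (hX : X.PosSemidef) (hR : R.PosDef) :
    (C * X * Cᴴ + R).PosDef ∧ ((C * X * Cᴴ + R)⁻¹)ᴴ = (C * X * Cᴴ + R)⁻¹ ∧
    (C * X * Cᴴ + R) * (C * X * Cᴴ + R)⁻¹ = 1 ∧ (C * X * Cᴴ + R)⁻¹ * (C * X * Cᴴ + R) = 1 := by
  have h : (C * X * Cᴴ + R).PosDef := Matrix.PosDef.posSemidef_add (hX.mul_mul_conjTranspose_same C) hR
  have hu := (Matrix.isUnit_iff_isUnit_det _).1 h.isUnit
  exact ⟨h, h.inv.isHermitian, Matrix.mul_nonsing_inv _ hu, Matrix.nonsing_inv_mul _ hu⟩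

/-- monotonicity of the lossy Riccati step in the state covariance,
process noise and measurement noise. -/
theorem stmt1 {n m : ℕ} (A : Matrix (Fin n) (Fin n) ℂ) (C : Matrix (Fin m) (Fin n) ℂ)
    (g : ℝ) (hg : g = 0 ∨ g = 1)
    (X X' Q Q' : Matrix (Fin n) (Fin n) ℂ) (R R' : Matrix (Fin m) (Fin m) ℂ)
    (hX : X.PosSemidef) (hX' : X'.PosSemidef) (hXX' : loe X X')
    (hQ : Q.IsHermitian) (hQ' : Q'.IsHermitian) (hQQ' : loe Q Q')
    (hR : R.PosDef) (hR' : R'.PosDef) (hRR' : loe R R') :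
    loe (riccStep A C Q R g X) (riccStep A C Q' R' g X') := by
  unfold loe at *
  rcases hg with rfl | rfl
  · have h := (hXX'.mul_mul_conjTranspose_same A).add hQQ'
    convert h using 1
    simp only [riccStep, Complex.ofReal_zero, zero_smul, Matrix.mul_sub, Matrix.sub_mul]
    abel
  · obtain ⟨hS, hT, h1, h2⟩ := ricc_inv_facts C X R hX hR
    obtain ⟨hS', hT', h1', h2'⟩ := ricc_inv_facts C X' R' hX' hR'
    simp only [riccStep, Complex.ofReal_one, one_smul]
    set T := (C * X * Cᴴ + R)⁻¹
    set T' := (C * X' * Cᴴ + R')⁻¹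
    set L := A * X' * Cᴴ * T' with hL
    have i1 := ricc_gain_identity A C X R T L hX.isHermitian hT h1 h2
    have i2 := ricc_gain_identity A C X' R' T' L hX'.isHermitian hT' h1' h2'
    rw [← hL, sub_self, Matrix.zero_mul, Matrix.zero_mul, add_zero] at i2
    have h := (((hXX'.mul_mul_conjTranspose_same (A - L * C)).add
      (hRR'.mul_mul_conjTranspose_same L)).add
      (hS.posSemidef.mul_mul_conjTranspose_same (L - A * X * Cᴴ * T))).add hQQ'
    convert h using 1
    have j1 := eq_sub_of_add_eq i1
    rw [add_sub_right_comm, i2, add_sub_right_comm (A * X * Aᴴ), j1, Matrix.mul_sub (A - L * C),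
      Matrix.sub_mul _ _ (A - L * C)ᴴ, Matrix.mul_sub L, Matrix.sub_mul _ _ Lᴴ]
    abel
end

section
/- Let A = diag(λ₁,…,λ_n) be a diagonal n×n complex matrix with columns of C ∈ ℂ^{m×n} denoted C₁,…,C_n, and let I ⊆ {1,…,n} be an index set with complement J, giving the block subsystem A_I = diag(λ_i : i ∈ I), C_I = (columns of C indexed by I). Let (γ_k) be i.i.d. Bernoulli random variables with P(γ_k = 1) = p on a probability space. Let P_k be the Riccati recursion for (A, C) with Q = Σ₀ = I_n and R = I_m, and let P_k^{(I)} be the Riccati recursion for (A_I, C_I) with identity parameters Q = Σ₀ = I_{|I|}, R = I_m, both driven by the same γ_k. If sup_k E[P_k] is bounded, then sup_k E[P_k^{(I)}] is bounded. (Equivalently, the critical arrival probability of any block of the system is at most the critical arrival probability of the full system: f_c(A,C) ≥ f_c(A_I, C_I).) -/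
open Matrix MeasureTheory ProbabilityTheory
open scoped ComplexOrder ENNReal

theorem ph_compl {ι κ : Type} [Fintype ι] [Fintype κ] [DecidableEq ι] [DecidableEq κ]
    (A : Matrix ι ι ℂ) (C : Matrix κ ι ℂ) (Q X : Matrix ι ι ℂ) (K : Matrix ι κ ℂ)
    (hX : X.PosSemidef) :
    (A - K * C) * X * (A - K * C)ᴴ + Q + K * Kᴴ =
      riccStep A C Q 1 1 X + (K - A * X * Cᴴ * (C * X * Cᴴ + 1)⁻¹) * (C * X * Cᴴ + 1) *
        (K - A * X * Cᴴ * (C * X * Cᴴ + 1)⁻¹)ᴴ := by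
  have hW : (C * X * Cᴴ + 1).PosDef :=
    Matrix.PosDef.posSemidef_add (hX.mul_mul_conjTranspose_same C) Matrix.PosDef.one
  have hu : IsUnit (C * X * Cᴴ + 1).det := (Matrix.isUnit_iff_isUnit_det _).1 hW.isUnit
  have hXh : Xᴴ = X := hX.1
  have hWh : (C * X * Cᴴ + 1)ᴴ = C * X * Cᴴ + 1 := hW.1
  have hKK : K * (C * X * Cᴴ + 1) * Kᴴ = K * (C * (X * (Cᴴ * Kᴴ))) + K * Kᴴ := by
    simp only [Matrix.mul_add, Matrix.add_mul, Matrix.mul_assoc, Matrix.mul_one]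
  unfold riccStep
  generalize hWd : C * X * Cᴴ + 1 = W at *
  have e1 : W * W⁻¹ = 1 := Matrix.mul_nonsing_inv _ hu
  have e2 : W⁻¹ * W = 1 := Matrix.nonsing_inv_mul _ hu
  have e3 : ∀ {l : Type} [Fintype l] (Z : Matrix κ l ℂ), W * (W⁻¹ * Z) = Z := by
    intro l _ Z; rw [← Matrix.mul_assoc, e1, Matrix.one_mul]
  have e4 : ∀ {l : Type} [Fintype l] (Z : Matrix κ l ℂ), W⁻¹ * (W * Z) = Z := by
    intro l _ Z; rw [← Matrix.mul_assoc, e2, Matrix.one_mul]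
  rw [Matrix.mul_assoc] at hKK
  simp only [Matrix.conjTranspose_sub, Matrix.conjTranspose_mul, Matrix.conjTranspose_conjTranspose,
    Matrix.conjTranspose_nonsing_inv, hWh, hXh, Matrix.mul_sub, Matrix.sub_mul, Matrix.mul_assoc,
    e3, e4, hKK, Complex.ofReal_one, one_smul]
  abel

theorem ph_step_psd {ι κ : Type} [Fintype ι] [Fintype κ] [DecidableEq ι] [DecidableEq κ]
    (A : Matrix ι ι ℂ) (C : Matrix κ ι ℂ) (Q X : Matrix ι ι ℂ) (g : ℝ) (hg : g = 0 ∨ g = 1)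
    (hQ : Q.PosSemidef) (hX : X.PosSemidef) : (riccStep A C Q 1 g X).PosSemidef := by
  rcases hg with rfl | rfl
  · simpa [riccStep] using (hX.mul_mul_conjTranspose_same A).add hQ
  · have h := ph_compl A C Q X (A * X * Cᴴ * (C * X * Cᴴ + 1)⁻¹) hX
    simp only [sub_self, Matrix.zero_mul, add_zero] at h
    rw [← h]
    exact ((hX.mul_mul_conjTranspose_same _).add hQ).add
      (Matrix.posSemidef_self_mul_conjTranspose _)

theorem ph_step_mono {ι κ : Type} [Fintype ι] [Fintype κ] [DecidableEq ι] [DecidableEq κ]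
    (A : Matrix ι ι ℂ) (C : Matrix κ ι ℂ) (Q Q' X Y : Matrix ι ι ℂ) (g : ℝ) (hg : g = 0 ∨ g = 1)
    (hQ : (Q' - Q).PosSemidef) (hX : X.PosSemidef) (hY : Y.PosSemidef)
    (hXY : (Y - X).PosSemidef) :
    (riccStep A C Q' 1 g Y - riccStep A C Q 1 g X).PosSemidef := by
  rcases hg with rfl | rfl
  · have h := (hXY.mul_mul_conjTranspose_same A).add hQ
    convert h using 1
    simp only [riccStep, Complex.ofReal_zero, zero_smul, Matrix.mul_sub, Matrix.sub_mul]
    abel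
  · have h := ph_compl A C Q' Y (A * Y * Cᴴ * (C * Y * Cᴴ + 1)⁻¹) hY
    have h2 := ph_compl A C Q X (A * Y * Cᴴ * (C * Y * Cᴴ + 1)⁻¹) hX
    simp only [sub_self, Matrix.zero_mul, add_zero] at h
    generalize A * Y * Cᴴ * (C * Y * Cᴴ + 1)⁻¹ = K at *
    have hW : (C * X * Cᴴ + 1).PosSemidef :=
      (hX.mul_mul_conjTranspose_same C).add Matrix.PosSemidef.one
    have h3 := ((hXY.mul_mul_conjTranspose_same (A - K * C)).add hQ).add
      (hW.mul_mul_conjTranspose_same (K - A * X * Cᴴ * (C * X * Cᴴ + 1)⁻¹))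
    rw [← h, eq_sub_of_add_eq h2.symm]
    convert h3 using 1
    rw [Matrix.mul_sub (A - K * C), Matrix.sub_mul _ _ (A - K * C)ᴴ]
    abel

theorem ph_emb {ι ι' κ : Type} [Fintype ι] [Fintype ι'] [Fintype κ] [DecidableEq ι]
    [DecidableEq ι'] [DecidableEq κ]
    (A : Matrix ι ι ℂ) (C : Matrix κ ι ℂ) (A' : Matrix ι' ι' ℂ) (C' : Matrix κ ι' ℂ)
    (S : Matrix ι ι' ℂ) (hA : A * S = S * A') (hC : C * S = C') (X : Matrix ι' ι' ℂ) (g : ℝ) :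
    S * riccStep A' C' 1 1 g X * Sᴴ = riccStep A C (S * Sᴴ) 1 g (S * X * Sᴴ) := by
  have hA2 : Sᴴ * Aᴴ = A'ᴴ * Sᴴ := by
    rw [← Matrix.conjTranspose_mul, hA, Matrix.conjTranspose_mul]
  have hC2 : Sᴴ * Cᴴ = C'ᴴ := by rw [← Matrix.conjTranspose_mul, hC]
  have e1 : A * (S * X * Sᴴ) = S * A' * X * Sᴴ := by
    rw [← hA]; simp only [Matrix.mul_assoc]
  have e2 : C * (S * X * Sᴴ) = C' * X * Sᴴ := by
    rw [← hC]; simp only [Matrix.mul_assoc]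
  unfold riccStep
  rw [e1, e2]
  simp only [Matrix.mul_assoc, hA2, hC2]
  simp only [Matrix.mul_sub, Matrix.sub_mul, Matrix.mul_add, Matrix.add_mul, Matrix.mul_smul,
    Matrix.smul_mul, Matrix.mul_assoc, Matrix.one_mul]

theorem ph_main {ι ι' κ : Type} [Fintype ι] [Fintype ι'] [Fintype κ] [DecidableEq ι]
    [DecidableEq ι'] [DecidableEq κ]
    (A : Matrix ι ι ℂ) (C : Matrix κ ι ℂ) (A' : Matrix ι' ι' ℂ) (C' : Matrix κ ι' ℂ)
    (S : Matrix ι ι' ℂ) (hA : A * S = S * A') (hC : C * S = C')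
    (hS : (1 - S * Sᴴ).PosSemidef) (γ : ℕ → ℝ) (h01 : ∀ k, γ k = 0 ∨ γ k = 1) (k : ℕ) :
    (ricc A' C' 1 1 1 γ k).PosSemidef ∧
    (ricc A C 1 1 1 γ k - S * ricc A' C' 1 1 1 γ k * Sᴴ).PosSemidef := by
  induction k with
  | zero => exact ⟨Matrix.PosSemidef.one, by simpa [ricc] using hS⟩
  | succ k ih =>
    obtain ⟨h1, h2⟩ := ih
    have h3 := h1.mul_mul_conjTranspose_same S
    have h4 : (ricc A C 1 1 1 γ k).PosSemidef := by simpa using h2.add h3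
    refine ⟨ph_step_psd _ _ _ _ _ (h01 k) Matrix.PosSemidef.one h1, ?_⟩
    simp only [ricc]
    rw [ph_emb A C A' C' S hA hC]
    exact ph_step_mono _ _ _ _ _ _ _ (h01 k) hS h3 h4 h2

theorem ph_congr {ι κ : Type} [Fintype ι] [Fintype κ] [DecidableEq ι] [DecidableEq κ]
    (A : Matrix ι ι ℂ) (C : Matrix κ ι ℂ) (γ γ' : ℕ → ℝ) (k : ℕ)
    (h : ∀ i, i < k → γ i = γ' i) : ricc A C 1 1 1 γ k = ricc A C 1 1 1 γ' k := by
  induction k with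
  | zero => rfl
  | succ k ih =>
    simp only [ricc]
    rw [ih (fun i hi => h i (by omega)), h k (by omega)]

theorem ph_integrable {ι κ Ω : Type} [Fintype ι] [Fintype κ] [DecidableEq ι] [DecidableEq κ]
    [MeasurableSpace Ω] (μ : Measure Ω) [IsProbabilityMeasure μ]
    (A : Matrix ι ι ℂ) (C : Matrix κ ι ℂ) (γ : ℕ → Ω → ℝ)
    (hmeas : ∀ k, Measurable (γ k))
    (h01 : ∀ k ω, γ k ω = 0 ∨ γ k ω = 1) (k : ℕ) (i j : ι) :
    Integrable (fun ω => ricc A C 1 1 1 (fun i => γ i ω) k i j) μ := by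
  classical
  let G : Ω → (Fin k → Bool) := fun ω i => decide (γ i ω = 1)
  let F : (Fin k → Bool) → ℂ := fun b =>
    ricc A C 1 1 1 (fun i => if h : i < k then (if b ⟨i, h⟩ = true then 1 else 0) else 0) k i j
  have hG : Measurable G := by
    refine measurable_pi_lambda _ fun i => ?_
    refine measurable_to_bool ?_
    have : (fun ω => G ω i) ⁻¹' {true} = (γ i) ⁻¹' {1} := by
      ext ω; simp [G]
    rw [this]
    exact hmeas i (measurableSet_singleton _)
  have hF : (fun ω => ricc A C 1 1 1 (fun i => γ i ω) k i j) = F ∘ G := by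
    funext ω
    simp only [Function.comp, F, G]
    rw [ph_congr]
    intro l hl
    rcases h01 l ω with h | h <;> simp [hl, h]
  rw [hF]
  have : IsFiniteMeasure (μ.map G) := inferInstance
  exact (Integrable.of_finite (μ := μ.map G) (f := F)).comp_measurable hG

theorem ph_exp_psd {ι Ω : Type} [Fintype ι] [MeasurableSpace Ω] (μ : Measure Ω)
    (D : Ω → Matrix ι ι ℂ) (hD : ∀ ω, (D ω).PosSemidef)
    (hint : ∀ i j, Integrable (fun ω => D ω i j) μ) : (matExp μ D).PosSemidef := by
  refine Matrix.PosSemidef.of_dotProduct_mulVec_nonneg ?_ ?_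
  · ext i j
    simp only [matExp, Matrix.conjTranspose_apply, Matrix.of_apply]
    rw [Complex.star_def, ← integral_conj]
    congr 1
    funext ω
    exact (hD ω).1.apply i j
  · intro x
    have : star x ⬝ᵥ (matExp μ D *ᵥ x) = ∫ ω, star x ⬝ᵥ (D ω *ᵥ x) ∂μ := by
      simp only [dotProduct, Matrix.mulVec, matExp, Matrix.of_apply]
      rw [integral_finsetSum]
      · refine Finset.sum_congr rfl fun i _ => ?_
        rw [integral_const_mul, integral_finsetSum]
        · simp only [integral_mul_const]
        · exact fun j _ => (hint i j).mul_const _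
      · exact fun i _ => (integrable_finsetSum _ fun j _ => (hint i j).mul_const _).const_mul _
    rw [this]
    exact integral_nonneg fun ω => (hD ω).dotProduct_mulVec_nonneg x

/-- if the expected error covariance of the full system `(A, C)` (with identity
noise parameters) is bounded, then so is that of any block subsystem `(A_I, C_I)`;
equivalently `f_c(A,C) ≥ f_c(A_I, C_I)`. -/
theorem stmt3 {n m : ℕ} (d : Fin n → ℂ) (C : Matrix (Fin m) (Fin n) ℂ)
    (I : Finset (Fin n))
    {Ω : Type} [MeasurableSpace Ω] (μ : Measure Ω) [IsProbabilityMeasure μ]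
    (γ : ℕ → Ω → ℝ) (p : ℝ)
    (hmeas : ∀ k, Measurable (γ k))
    (hind : iIndepFun γ μ)
    (h01 : ∀ k ω, γ k ω = 0 ∨ γ k ω = 1)
    (hber : ∀ k, μ {ω | γ k ω = 1} = ENNReal.ofReal p) :
    EBounded μ (fun k ω => ricc (Matrix.diagonal d) C 1 1 1 (fun i => γ i ω) k) →
    EBounded μ (fun k ω =>
      ricc (Matrix.diagonal (fun j : ↥I => d j.1))
        (C.submatrix id (fun j : ↥I => (j.1 : Fin n))) 1 1 1 (fun i => γ i ω) k) := by
  rintro ⟨hi, M, hM, hMk⟩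
  have hi' := fun k i j => ph_integrable μ (Matrix.diagonal (fun j : ↥I => d j.1))
        (C.submatrix id (fun j : ↥I => (j.1 : Fin n))) γ hmeas h01 k i j
  refine ⟨hi', M.submatrix Subtype.val Subtype.val, hM.submatrix _, fun k => ?_⟩
  let S : Matrix (Fin n) ↥I ℂ := (1 : Matrix (Fin n) (Fin n) ℂ).submatrix id Subtype.val
  have hA : Matrix.diagonal d * S = S * Matrix.diagonal (fun j : ↥I => d j.1) := by
    ext i j
    simp only [S, Matrix.diagonal_mul, Matrix.mul_diagonal, Matrix.submatrix_apply, id,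
      Matrix.one_apply]
    split_ifs with h <;> simp [h]
  have hC : C * S = C.submatrix id (fun j : ↥I => (j.1 : Fin n)) := by
    ext i j
    simp [S, Matrix.mul_apply, Matrix.one_apply]
  have hSS : Sᴴ * S = 1 := by
    ext i j
    by_cases h : i = j
    · simp [S, Matrix.mul_apply, Matrix.one_apply, h]
    · have h2 : (i : Fin n) ≠ j := fun e => h (Subtype.ext e)
      simp [S, Matrix.mul_apply, Matrix.one_apply, h, h2, h2.symm]
  have hS : (1 - S * Sᴴ).PosSemidef := by
    have h := Matrix.posSemidef_self_mul_conjTranspose (1 - S * Sᴴ)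
    have e : (1 - S * Sᴴ) * (1 - S * Sᴴ)ᴴ = 1 - S * Sᴴ := by
      have e2 : S * Sᴴ * (S * Sᴴ) = S * Sᴴ := by
        rw [Matrix.mul_assoc, ← Matrix.mul_assoc Sᴴ, hSS, Matrix.one_mul]
      simp only [Matrix.conjTranspose_sub, Matrix.conjTranspose_one, Matrix.conjTranspose_mul,
        Matrix.conjTranspose_conjTranspose, Matrix.mul_sub, Matrix.sub_mul, e2,
        Matrix.mul_one, Matrix.one_mul]
      abel
    rwa [e] at h
  have hsub : ∀ Y : Matrix (Fin n) (Fin n) ℂ, Sᴴ * Y * S = Y.submatrix Subtype.val Subtype.val := by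
    intro Y
    ext i j
    simp [S, Matrix.mul_apply, Matrix.one_apply]
  have key : ∀ ω, ((ricc (Matrix.diagonal d) C 1 1 1 (fun i => γ i ω) k).submatrix
      Subtype.val Subtype.val - ricc (Matrix.diagonal (fun j : ↥I => d j.1))
        (C.submatrix id (fun j : ↥I => (j.1 : Fin n))) 1 1 1 (fun i => γ i ω) k).PosSemidef := by
    intro ω
    have h := (ph_main _ C _ _ S hA hC hS (fun i => γ i ω) (fun i => h01 i ω) k).2
    have h2 := h.conjTranspose_mul_mul_same S
    rw [← hsub]
    convert h2 using 1
    rw [Matrix.mul_sub, Matrix.sub_mul]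
    congr 1
    simp only [Matrix.mul_assoc, hSS, Matrix.mul_one]
    rw [← Matrix.mul_assoc, hSS, Matrix.one_mul]
  have h1 := ph_exp_psd μ _ key (fun i j => (hi k i j).sub (hi' k i j))
  have h2 := (hMk k).submatrix (Subtype.val : ↥I → Fin n)
  have h3 := h2.add h1
  unfold loe
  convert h3 using 1
  ext i j
  simp only [matExp, Matrix.add_apply, Matrix.sub_apply, Matrix.submatrix_apply, Matrix.of_apply]
  rw [integral_sub (hi k i j) (hi' k i j)]
  ring
end
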